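/- arXiv:1808.09987 — 2 statements merged into one kernel-verified Lean document; each statement's English description precedes it below -/
import Mathlib

section
/- Let η ∈ (0, 1/2], let A ∈ ℝ^{m×n} have nonnegative entries, let x ∈ ℝ^n be nonnegative with ‖Ax‖_∞ ≤ 1, and let M be a diagonal matrix with diagonal entries M_ii ∈ [0,1]. Set d = η·M·x and assume (1/η)·‖Ad‖_∞ ≤ 1/2. Then smax_η(A(x + d)) ≤ smax_η(Ax) + η·⟨Aᵀ∇smax_η(Ax), Mx + M²x⟩. -/
/-- The softmax function `smax_η(z) = η ln(∑_j e^{z_j/η})`. -/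
noncomputable def smax {m : ℕ} (η : ℝ) (z : Fin m → ℝ) : ℝ :=
  η * Real.log (∑ j, Real.exp (z j / η))

/-- The `j`-th coordinate of the gradient of the softmax function. -/
noncomputable def smaxGrad {m : ℕ} (η : ℝ) (z : Fin m → ℝ) (j : Fin m) : ℝ :=
  Real.exp (z j / η) / ∑ l, Real.exp (z l / η)

/-- A second-order upper bound for the softmax at steps of size at most `η`. -/
theorem smax_add_le {m : ℕ} {η : ℝ} (hη : 0 < η) (z δ : Fin m → ℝ)
    (hδ : ∀ j, |δ j / η| ≤ 1) :
    smax η (z + δ) ≤ smax η z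
      + η * ∑ j, smaxGrad η z j * (δ j / η + (δ j / η) ^ 2) := by
  rcases isEmpty_or_nonempty (Fin m) with h | h
  · simp [smax]
  have hZ : 0 < ∑ j, Real.exp (z j / η) :=
    Finset.sum_pos (fun _ _ => Real.exp_pos _) Finset.univ_nonempty
  have hW : 0 < ∑ j, Real.exp ((z + δ) j / η) :=
    Finset.sum_pos (fun _ _ => Real.exp_pos _) Finset.univ_nonempty
  simp only [smax, smaxGrad]
  rw [← mul_add]
  refine mul_le_mul_of_nonneg_left ?_ hη.le
  rw [← sub_le_iff_le_add', ← Real.log_div hW.ne' hZ.ne']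
  refine (Real.log_le_sub_one_of_pos (div_pos hW hZ)).trans ?_
  rw [div_sub_one hZ.ne', ← Finset.sum_sub_distrib, Finset.sum_div]
  refine Finset.sum_le_sum fun j _ => ?_
  rw [div_mul_eq_mul_div, Pi.add_apply, add_div, Real.exp_add, ← mul_sub_one]
  gcongr
  linarith [(abs_le.mp (Real.abs_exp_sub_one_sub_id_le (hδ j))).2]

/-- Cauchy-Schwarz for the weights `a i * x i`, whose total mass is at most one. -/
theorem sq_sum_mul_le {ι : Type*} [Fintype ι] {a x : ι → ℝ} (M : ι → ℝ)
    (ha : ∀ i, 0 ≤ a i) (hx : ∀ i, 0 ≤ x i) (hax : ∑ i, a i * x i ≤ 1) :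
    (∑ i, a i * (M i * x i)) ^ 2 ≤ ∑ i, a i * (M i ^ 2 * x i) := by
  have hnonneg : ∀ i, 0 ≤ a i * (M i ^ 2 * x i) := fun i =>
    mul_nonneg (ha i) (mul_nonneg (sq_nonneg _) (hx i))
  calc (∑ i, a i * (M i * x i)) ^ 2
      ≤ (∑ i, a i * x i) * ∑ i, a i * (M i ^ 2 * x i) :=
        Finset.sum_sq_le_sum_mul_sum_of_sq_le_mul _
          (fun i _ => mul_nonneg (ha i) (hx i)) (fun i _ => hnonneg i) (fun i _ => le_of_eq (by ring))
    _ ≤ ∑ i, a i * (M i ^ 2 * x i) :=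
        mul_le_of_le_one_left (Finset.sum_nonneg fun i _ => hnonneg i) hax

/-- for `η ∈ (0,1/2]`, a nonnegative matrix `A`, a nonnegative `x` with
`‖Ax‖_∞ ≤ 1`, a diagonal matrix `M` (given by its diagonal entries `M i ∈ [0,1]`), and
`d = η·M·x` with `(1/η)‖Ad‖_∞ ≤ 1/2`, the softmax increase is bounded by
`η⟨Aᵀ∇smax_η(Ax), Mx + M²x⟩`. -/
theorem stmt_5 (m n : ℕ) (η : ℝ) (hη0 : 0 < η) (hη : η ≤ 1 / 2)
    (A : Matrix (Fin m) (Fin n) ℝ) (hA : ∀ j i, 0 ≤ A j i)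
    (x : Fin n → ℝ) (hx : 0 ≤ x) (hAx : ‖A.mulVec x‖ ≤ 1)
    (M : Fin n → ℝ) (hM : ∀ i, M i ∈ Set.Icc (0:ℝ) 1)
    (d : Fin n → ℝ) (hd : d = fun i => η * (M i * x i))
    (hstep : (1 / η) * ‖A.mulVec d‖ ≤ 1 / 2) :
    smax η (A.mulVec (x + d)) ≤ smax η (A.mulVec x)
      + η * ∑ i, (∑ j, A j i * smaxGrad η (A.mulVec x) j)
          * (M i * x i + M i ^ 2 * x i) := by
  have hquot : ∀ j, A.mulVec d j / η = ∑ i, A j i * (M i * x i) := by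
    intro j
    rw [div_eq_iff hη0.ne', hd, Finset.sum_mul]
    change ∑ i, A j i * (η * (M i * x i)) = _
    exact Finset.sum_congr rfl fun i _ => by ring
  have hsmall : ∀ j, |A.mulVec d j / η| ≤ 1 := by
    intro j
    rw [abs_div, abs_of_pos hη0, div_eq_inv_mul, ← one_div]
    have h := mul_le_mul_of_nonneg_left (norm_le_pi_norm (A.mulVec d) j)
      (one_div_nonneg.mpr hη0.le)
    rw [Real.norm_eq_abs] at h
    linarith
  have hmass : ∀ j, ∑ i, A j i * x i ≤ 1 := fun j =>
    (le_abs_self _).trans ((norm_le_pi_norm (A.mulVec x) j).trans hAx)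
  rw [Matrix.mulVec_add]
  refine (smax_add_le hη0 _ _ hsmall).trans ?_
  gcongr
  simp_rw [Finset.sum_mul]
  rw [Finset.sum_comm]
  refine Finset.sum_le_sum fun j _ => ?_
  have hgrad : 0 ≤ smaxGrad η (A.mulVec x) j := by
    unfold smaxGrad
    positivity
  calc smaxGrad η (A.mulVec x) j * (A.mulVec d j / η + (A.mulVec d j / η) ^ 2)
      ≤ smaxGrad η (A.mulVec x) j
          * (∑ i, A j i * (M i * x i) + ∑ i, A j i * (M i ^ 2 * x i)) := by
        rw [hquot]
        gcongr
        exact sq_sum_mul_le M (hA j) hx (hmass j)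
    _ = _ := by
        rw [← Finset.sum_add_distrib, Finset.mul_sum]
        exact Finset.sum_congr rfl fun i _ => by ring
end

section
/- Let f : [0,1]^n → ℝ be differentiable, monotone (x ≤ y implies f(x) ≤ f(y)), and DR-submodular (its gradient is antitone). Let A ∈ ℝ^{m×n} have nonnegative entries, let η ∈ (0, 1/2] and λ > 0, and let x ∈ ℝ^n be nonnegative with (1+η)x ∈ [0,1]^n and ‖Ax‖_∞ ≤ 1. Define c_i = ∇_i f((1+η)x), m_i = max(1 − λ·(Aᵀ∇smax_η(Ax))_i / c_i, 0) when c_i > 0 and m_i = 0 when c_i = 0, and d = η·(x ∘ m) (coordinatewise product). Assume (1/η)·‖Ad‖_∞ ≤ 1/2. Then f(x + d) − f(x) ≥ λ·(smax_η(A(x + d)) − smax_η(Ax)). -/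
/-- The `i`-th coordinate of the gradient of `f : ℝ^n → ℝ` at `x`. -/
noncomputable def fgrad {n : ℕ} (f : (Fin n → ℝ) → ℝ) (x : Fin n → ℝ) (i : Fin n) : ℝ :=
  fderiv ℝ f x (Pi.single i 1)

/-- Second-order upper bound for the softmax function along small displacements. -/
theorem smax_add_sub_le {m : ℕ} {η : ℝ} (hη : 0 < η) (z δ : Fin m → ℝ)
    (hδ : ∀ j, |δ j / η| ≤ 1) :
    smax η (z + δ) - smax η z ≤ ∑ j, smaxGrad η z j * (δ j + δ j ^ 2 / η) := by
  rcases isEmpty_or_nonempty (Fin m) with h | h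
  · simp [smax]
  have hS : 0 < ∑ l, Real.exp (z l / η) :=
    Finset.sum_pos (fun _ _ => Real.exp_pos _) Finset.univ_nonempty
  have hT : 0 < ∑ l, Real.exp ((z + δ) l / η) :=
    Finset.sum_pos (fun _ _ => Real.exp_pos _) Finset.univ_nonempty
  have hle : ∑ l, Real.exp ((z + δ) l / η) ≤
      ∑ l, Real.exp (z l / η) * (1 + δ l / η + (δ l / η) ^ 2) := by
    refine Finset.sum_le_sum fun l _ => ?_
    rw [Pi.add_apply, add_div, Real.exp_add]
    have := (abs_le.1 (Real.abs_exp_sub_one_sub_id_le (hδ l))).2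
    exact mul_le_mul_of_nonneg_left (by linarith) (Real.exp_pos _).le
  have hlog := Real.log_le_sub_one_of_pos (div_pos hT hS)
  rw [Real.log_div hT.ne' hS.ne'] at hlog
  calc smax η (z + δ) - smax η z
      ≤ η * ((∑ l, Real.exp ((z + δ) l / η)) / (∑ l, Real.exp (z l / η)) - 1) := by
        rw [smax, smax, ← mul_sub]
        exact mul_le_mul_of_nonneg_left hlog hη.le
    _ ≤ η * ((∑ l, Real.exp (z l / η) * (1 + δ l / η + (δ l / η) ^ 2)) /
          (∑ l, Real.exp (z l / η)) - 1) := by gcongr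
    _ = ∑ j, smaxGrad η z j * (δ j + δ j ^ 2 / η) := by
        simp only [smaxGrad, div_mul_eq_mul_div]
        rw [← Finset.sum_div, div_sub_one hS.ne', ← Finset.sum_sub_distrib, mul_div_assoc',
          Finset.mul_sum]
        congr 1
        refine Finset.sum_congr rfl fun j _ => ?_
        field_simp
        ring

theorem smaxGrad_nonneg {m : ℕ} (η : ℝ) (z : Fin m → ℝ) (j : Fin m) : 0 ≤ smaxGrad η z j := by
  unfold smaxGrad
  positivity

theorem fderiv_apply_eq_sum_fgrad {n : ℕ} (f : (Fin n → ℝ) → ℝ) (x d : Fin n → ℝ) :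
    fderiv ℝ f x d = ∑ i, d i * fgrad f x i := by
  conv_lhs => rw [pi_eq_sum_univ' d, map_sum]
  simp [fgrad]

/-- The gradient of a function monotone on the unit box is nonnegative on the box. -/
theorem fgrad_nonneg {n : ℕ} {f : (Fin n → ℝ) → ℝ} (hf : Differentiable ℝ f)
    (hmono : ∀ x y : Fin n → ℝ, (∀ i, x i ∈ Set.Icc (0 : ℝ) 1) →
      (∀ i, y i ∈ Set.Icc (0 : ℝ) 1) → x ≤ y → f x ≤ f y)
    {y : Fin n → ℝ} (hy : ∀ i, y i ∈ Set.Icc (0 : ℝ) 1) (i : Fin n) : 0 ≤ fgrad f y i := by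
  have hbox : ∀ t ∈ Set.Icc (0 : ℝ) 1, ∀ k, Function.update y i t k ∈ Set.Icc (0 : ℝ) 1 := by
    intro t ht k
    rcases eq_or_ne k i with rfl | hk
    · simpa using ht
    · simpa [hk] using hy k
  have hm : MonotoneOn (fun t => f (Function.update y i t)) (Set.Icc 0 1) := fun s hs t ht hst =>
    hmono _ _ (hbox s hs) (hbox t ht) (update_le_update_iff.2 ⟨hst, fun _ _ => le_rfl⟩)
  have hfd : HasFDerivAt f (fderiv ℝ f y) (Function.update y i (y i)) := by
    rw [Function.update_eq_self]
    exact (hf y).hasFDerivAt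
  have hd : HasDerivAt (fun t => f (Function.update y i t)) (fgrad f y i) (y i) :=
    hfd.comp_hasDerivAt (y i) (hasDerivAt_update y i (y i))
  have hu := uniqueDiffOn_Icc (zero_lt_one' ℝ) (y i) (hy i)
  rw [← hd.hasDerivWithinAt.derivWithin hu]
  exact hm.derivWithin_nonneg

/-- Along a nonnegative direction, a DR-submodular function grows at least as fast as its
linearisation at any point above the segment. -/
theorem sum_mul_fgrad_le_sub {n : ℕ} {f : (Fin n → ℝ) → ℝ} (hf : Differentiable ℝ f)
    (hDR : ∀ x y : Fin n → ℝ, (∀ i, x i ∈ Set.Icc (0 : ℝ) 1) →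
      (∀ i, y i ∈ Set.Icc (0 : ℝ) 1) → x ≤ y → ∀ i, fgrad f y i ≤ fgrad f x i)
    {x d y : Fin n → ℝ} (hx : 0 ≤ x) (hd : 0 ≤ d) (hxy : x + d ≤ y)
    (hy : ∀ i, y i ∈ Set.Icc (0 : ℝ) 1) :
    ∑ i, d i * fgrad f y i ≤ f (x + d) - f x := by
  have hder : ∀ t : ℝ, HasDerivAt (fun t : ℝ => f (x + t • d)) (fderiv ℝ f (x + t • d) d) t := by
    intro t
    have h : HasDerivAt (fun t : ℝ => x + t • d) d t := by
      simpa using ((hasDerivAt_id t).smul_const d).const_add x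
    exact (hf _).hasFDerivAt.comp_hasDerivAt t h
  obtain ⟨t, ht, hslope⟩ := exists_hasDerivAt_eq_slope (fun t : ℝ => f (x + t • d)) _
    zero_lt_one (fun t _ => (hder t).continuousAt.continuousWithinAt) (fun t _ => hder t)
  have hle : x + t • d ≤ y := fun i => by
    have h1 := hxy i
    have h2 := mul_le_of_le_one_left (hd i) ht.2.le
    simp only [Pi.add_apply, Pi.smul_apply, smul_eq_mul] at *
    linarith
  have hbox : ∀ i, (x + t • d) i ∈ Set.Icc (0 : ℝ) 1 := fun i =>
    ⟨add_nonneg (hx i) (mul_nonneg ht.1.le (hd i)), (hle i).trans (hy i).2⟩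
  simp only [one_smul, zero_smul, add_zero, sub_zero, div_one] at hslope
  rw [← hslope, fderiv_apply_eq_sum_fgrad]
  exact Finset.sum_le_sum fun i _ =>
    mul_le_mul_of_nonneg_left (hDR _ _ hbox hy hle i) (hd i)

/-- the per-iteration progress guarantee of the monotone packing algorithm:
with `c = ∇f((1+η)x)`, `m_i = max(1 - λ (Aᵀ∇smax_η(Ax))_i / c_i, 0)` (and `0` when
`c_i = 0`), and `d = η (x ∘ m)`, if `(1/η)‖Ad‖_∞ ≤ 1/2` then
`f(x+d) - f(x) ≥ λ (smax_η(A(x+d)) - smax_η(Ax))`. -/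
theorem stmt_10 (n m : ℕ) (f : (Fin n → ℝ) → ℝ) (hf : Differentiable ℝ f)
    (hmono : ∀ x y : Fin n → ℝ, (∀ i, x i ∈ Set.Icc (0:ℝ) 1) →
      (∀ i, y i ∈ Set.Icc (0:ℝ) 1) → x ≤ y → f x ≤ f y)
    (hDR : ∀ x y : Fin n → ℝ, (∀ i, x i ∈ Set.Icc (0:ℝ) 1) →
      (∀ i, y i ∈ Set.Icc (0:ℝ) 1) → x ≤ y → ∀ i, fgrad f y i ≤ fgrad f x i)
    (A : Matrix (Fin m) (Fin n) ℝ) (hA : ∀ j i, 0 ≤ A j i)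
    (η lam : ℝ) (hη0 : 0 < η) (hη : η ≤ 1 / 2) (hlam : 0 < lam)
    (x : Fin n → ℝ) (hx : 0 ≤ x)
    (hbox : ∀ i, (1 + η) * x i ∈ Set.Icc (0:ℝ) 1)
    (hAx : ‖A.mulVec x‖ ≤ 1)
    (c M d : Fin n → ℝ)
    (hc : c = fun i => fgrad f ((1 + η) • x) i)
    (hM : ∀ i, (0 < c i →
        M i = max (1 - lam * (∑ j, A j i * smaxGrad η (A.mulVec x) j) / c i) 0)
      ∧ (c i = 0 → M i = 0))
    (hd : d = fun i => η * (x i * M i))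
    (hstep : (1 / η) * ‖A.mulVec d‖ ≤ 1 / 2) :
    lam * (smax η (A.mulVec (x + d)) - smax η (A.mulVec x)) ≤ f (x + d) - f x := by
  set p := smaxGrad η (A.mulVec x) with hp
  set q : Fin n → ℝ := fun i => ∑ j, A j i * p j with hq
  have hp0 : ∀ j, 0 ≤ p j := smaxGrad_nonneg η _
  have hq0 : ∀ i, 0 ≤ q i := fun i => Finset.sum_nonneg fun j _ => mul_nonneg (hA j i) (hp0 j)
  have hy : ∀ i, ((1 + η) • x) i ∈ Set.Icc (0 : ℝ) 1 := hbox
  have hc0 : ∀ i, 0 ≤ c i := fun i => by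
    rw [hc]
    exact fgrad_nonneg hf hmono hy i
  have hMi : ∀ i, 0 ≤ M i ∧ M i ≤ 1 ∧ M i * (lam * q i) = M i * (c i * (1 - M i)) := by
    intro i
    rcases (hc0 i).eq_or_lt with h | h
    · simp [(hM i).2 h.symm]
    · have hMeq : M i = max (1 - lam * q i / c i) 0 := (hM i).1 h
      have hr : 0 ≤ lam * q i / c i := div_nonneg (mul_nonneg hlam.le (hq0 i)) h.le
      refine ⟨hMeq ▸ le_max_right _ _, hMeq ▸ max_le (by linarith) zero_le_one, ?_⟩
      rcases max_cases (1 - lam * q i / c i) 0 with ⟨h1, -⟩ | ⟨h1, -⟩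
      · rw [hMeq, h1]
        field_simp
        ring
      · rw [hMeq, h1]
        simp
  have hd0 : 0 ≤ d := fun i => by
    rw [hd]
    exact mul_nonneg hη0.le (mul_nonneg (hx i) (hMi i).1)
  have hxd : x + d ≤ (1 + η) • x := fun i => by
    have h := mul_le_mul_of_nonneg_left (mul_le_of_le_one_right (hx i) (hMi i).2.1) hη0.le
    simp only [hd, Pi.add_apply, Pi.smul_apply, smul_eq_mul]
    linarith
  have hfd := sum_mul_fgrad_le_sub hf hDR hx hd0 hxd hy
  have hδ : ∀ j, |A.mulVec d j / η| ≤ 1 := fun j => by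
    have h := norm_le_pi_norm (A.mulVec d) j
    rw [Real.norm_eq_abs] at h
    rw [abs_div, abs_of_pos hη0, div_eq_inv_mul, ← one_div]
    exact (mul_le_mul_of_nonneg_left h (by positivity)).trans (hstep.trans (by norm_num))
  have hsq : ∀ j, A.mulVec d j ^ 2 / η ≤ ∑ i, A j i * (η * (x i * M i ^ 2)) := by
    intro j
    have hAxj : ∑ i, A j i * x i ≤ 1 :=
      ((Real.le_norm_self _).trans (norm_le_pi_norm (A.mulVec x) j)).trans hAx
    have hcs : (∑ i, A j i * (x i * M i)) ^ 2 ≤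
        (∑ i, A j i * x i) * ∑ i, A j i * (x i * M i ^ 2) :=
      Finset.sum_sq_le_sum_mul_sum_of_sq_le_mul _ (fun i _ => mul_nonneg (hA j i) (hx i))
        (fun i _ => mul_nonneg (hA j i) (mul_nonneg (hx i) (sq_nonneg _)))
        (fun i _ => le_of_eq (by ring))
    have hnn : 0 ≤ ∑ i, A j i * (x i * M i ^ 2) :=
      Finset.sum_nonneg fun i _ => mul_nonneg (hA j i) (mul_nonneg (hx i) (sq_nonneg _))
    have hAd : A.mulVec d j = η * ∑ i, A j i * (x i * M i) := by
      simp only [hd, Matrix.mulVec, dotProduct, Finset.mul_sum, mul_left_comm (A j _) η]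
    calc A.mulVec d j ^ 2 / η = η * (∑ i, A j i * (x i * M i)) ^ 2 := by
          rw [hAd]
          field_simp
      _ ≤ η * ∑ i, A j i * (x i * M i ^ 2) :=
          mul_le_mul_of_nonneg_left (hcs.trans (mul_le_of_le_one_left hnn hAxj)) hη0.le
      _ = ∑ i, A j i * (η * (x i * M i ^ 2)) := by
          rw [Finset.mul_sum]
          exact Finset.sum_congr rfl fun i _ => mul_left_comm _ _ _
  have hsm : smax η (A.mulVec (x + d)) - smax η (A.mulVec x) ≤
      ∑ i, q i * (d i + η * (x i * M i ^ 2)) := by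
    rw [Matrix.mulVec_add]
    calc smax η (A.mulVec x + A.mulVec d) - smax η (A.mulVec x)
        ≤ ∑ j, p j * (A.mulVec d j + A.mulVec d j ^ 2 / η) := smax_add_sub_le hη0 _ _ hδ
      _ ≤ ∑ j, p j * (∑ i, A j i * d i + ∑ i, A j i * (η * (x i * M i ^ 2))) :=
          Finset.sum_le_sum fun j _ =>
            mul_le_mul_of_nonneg_left (add_le_add le_rfl (hsq j)) (hp0 j)
      _ = ∑ i, q i * (d i + η * (x i * M i ^ 2)) := by
          simp only [hq, ← Finset.sum_add_distrib, Finset.mul_sum, Finset.sum_mul]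
          rw [Finset.sum_comm]
          exact Finset.sum_congr rfl fun i _ => Finset.sum_congr rfl fun j _ => by ring
  calc lam * (smax η (A.mulVec (x + d)) - smax η (A.mulVec x))
      ≤ lam * ∑ i, q i * (d i + η * (x i * M i ^ 2)) := mul_le_mul_of_nonneg_left hsm hlam.le
    _ ≤ ∑ i, d i * fgrad f ((1 + η) • x) i := by
        rw [Finset.mul_sum]
        refine Finset.sum_le_sum fun i _ => ?_
        have hci : fgrad f ((1 + η) • x) i = c i := by rw [hc]
        have hdi : d i = η * (x i * M i) := by rw [hd]
        have hrest : 0 ≤ η * x i * (c i * M i ^ 2 * M i) :=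
          mul_nonneg (mul_nonneg hη0.le (hx i))
            (mul_nonneg (mul_nonneg (hc0 i) (sq_nonneg _)) (hMi i).1)
        rw [hci, hdi]
        linear_combination η * x i * (1 + M i) * (hMi i).2.2 + hrest
    _ ≤ f (x + d) - f x := hfd
end
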